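/- arXiv:2510.13406 — 3 statements merged into one kernel-verified Lean document; each statement's English description precedes it below -/
import Mathlib

section
/- Let D and N be positive integers and let X, Y be real D×N matrices with columns x₁,…,x_N and y₁,…,y_N, each of Euclidean norm 1. Assume that (1/N²) · Σ_{i=1}^N Σ_{j=1}^N (xᵢᵀxⱼ − yᵢᵀyⱼ)² ≤ δ² for some δ ≥ 0. Let Q be a D×D orthogonal matrix minimizing ‖QX − Y‖_F over all orthogonal matrices, and write x̄ᵢ = Q xᵢ. Then (1/N²) · Σ_{i,j} (x̄ᵢᵀyⱼ − yᵢᵀyⱼ)² ≤ √(2D) · δ and (1/N²) · Σ_{i,j} (x̄ᵢᵀyⱼ − xᵢᵀxⱼ)² ≤ √(2D) · δ. -/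
open Matrix

/-- The Frobenius norm of a real matrix: `‖A‖_F = (Σ_{i,j} A_{ij}²)^{1/2}`. -/
noncomputable def frobNorm {m n : Type*} [Fintype m] [Fintype n] (A : Matrix m n ℝ) : ℝ :=
  Real.sqrt (∑ i, ∑ j, (A i j) ^ 2)

section Auxiliary

variable {m n : Type*} [Fintype m] [Fintype n]

lemma frobNorm_sq_eq_trace (A : Matrix m n ℝ) : frobNorm A ^ 2 = (A * Aᵀ).trace := by
  rw [frobNorm, Real.sq_sqrt (by positivity)]
  simp [Matrix.trace, Matrix.mul_apply, sq]

/-- Multiplying on the left by an orthogonal matrix changes only the cross term of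
`‖A - Y‖_F²`. -/
lemma frobNorm_orthogonal_mul_sub_sq [DecidableEq m] (R : Matrix m m ℝ) (hR : Rᵀ * R = 1)
    (A Y : Matrix m n ℝ) :
    frobNorm (R * A - Y) ^ 2 =
      (A * Aᵀ).trace + (Y * Yᵀ).trace - 2 * (R * (A * Yᵀ)).trace := by
  have h₁ : (R * A * (R * A)ᵀ).trace = (A * Aᵀ).trace := by
    rw [Matrix.trace_mul_comm, Matrix.transpose_mul, Matrix.mul_assoc, ← Matrix.mul_assoc Rᵀ, hR,
      Matrix.one_mul, Matrix.trace_mul_comm]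
  have h₂ : (Y * (R * A)ᵀ).trace = (R * (A * Yᵀ)).trace := by
    rw [← Matrix.trace_transpose, Matrix.transpose_mul, Matrix.transpose_transpose,
      Matrix.mul_assoc]
  rw [frobNorm_sq_eq_trace, Matrix.transpose_sub, Matrix.sub_mul, Matrix.mul_sub, Matrix.mul_sub,
    Matrix.trace_sub, Matrix.trace_sub, Matrix.trace_sub, h₁, h₂, Matrix.mul_assoc]
  ring

/-- The Householder reflection in the hyperplane orthogonal to `v`. -/
noncomputable def householder [DecidableEq m] (v : m → ℝ) : Matrix m m ℝ :=
  1 - (2 / (v ⬝ᵥ v)) • Matrix.vecMulVec v v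

lemma householder_transpose_mul_self [DecidableEq m] (v : m → ℝ) (hv : v ⬝ᵥ v ≠ 0) :
    (householder v)ᵀ * householder v = 1 := by
  have h : (2 / (v ⬝ᵥ v)) * ((2 / (v ⬝ᵥ v)) * (v ⬝ᵥ v)) = 2 * (2 / (v ⬝ᵥ v)) := by
    field_simp
  have ht : (householder v)ᵀ = householder v := by
    simp [householder, Matrix.transpose_vecMulVec]
  rw [ht, householder, Matrix.sub_mul, Matrix.one_mul, Matrix.mul_sub, Matrix.mul_one,
    Matrix.smul_mul, Matrix.mul_smul, Matrix.vecMulVec_mul_vecMulVec]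
  ext i j
  simp only [Matrix.sub_apply, Matrix.smul_apply, Matrix.vecMulVec_apply, smul_eq_mul,
    Pi.smul_apply]
  linear_combination v i * v j * h

lemma householder_mulVec [DecidableEq m] (v w : m → ℝ) :
    householder v *ᵥ w = w - (2 / (v ⬝ᵥ v) * (v ⬝ᵥ w)) • v := by
  ext i
  simp [householder, Matrix.sub_mulVec, Matrix.smul_mulVec, Matrix.vecMulVec_mulVec]
  ring

lemma trace_householder_mul [DecidableEq m] (v : m → ℝ) (A : Matrix m m ℝ) :
    (householder v * A).trace = A.trace - 2 / (v ⬝ᵥ v) * (v ⬝ᵥ A *ᵥ v) := by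
  rw [householder, Matrix.sub_mul, Matrix.one_mul, Matrix.trace_sub, Matrix.smul_mul,
    Matrix.trace_smul, Matrix.vecMulVec_mul, Matrix.trace_vecMulVec, smul_eq_mul,
    Matrix.dotProduct_mulVec, dotProduct_comm v (v ᵥ* A)]

/-- A matrix whose trace cannot be increased by an orthogonal factor is nonnegative as a
quadratic form. -/
lemma dotProduct_mulVec_nonneg_of_trace_max [DecidableEq m] (M : Matrix m m ℝ)
    (hM : ∀ R : Matrix m m ℝ, Rᵀ * R = 1 → (R * M).trace ≤ M.trace) (v : m → ℝ) :
    0 ≤ v ⬝ᵥ M *ᵥ v := by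
  by_cases hv : v ⬝ᵥ v = 0
  · rw [dotProduct_self_eq_zero] at hv
    simp [hv]
  have hpos : 0 < v ⬝ᵥ v :=
    lt_of_le_of_ne (Finset.sum_nonneg fun i _ => mul_self_nonneg (v i)) (Ne.symm hv)
  have h := hM _ (householder_transpose_mul_self v hv)
  rw [trace_householder_mul] at h
  have h' : 0 ≤ 2 / (v ⬝ᵥ v) * (v ⬝ᵥ M *ᵥ v) := by linarith
  exact nonneg_of_mul_nonneg_right h' (by positivity)

/-- A matrix whose trace cannot be increased by an orthogonal factor is symmetric. -/
lemma transpose_eq_of_trace_max [DecidableEq m] (M : Matrix m m ℝ)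
    (hM : ∀ R : Matrix m m ℝ, Rᵀ * R = 1 → (R * M).trace ≤ M.trace) : Mᵀ = M := by
  ext i j
  rw [Matrix.transpose_apply]
  by_cases hij : i = j
  · rw [hij]
  have key : ∀ t : ℝ, t * (M j i - M i j) ≤ t ^ 2 * (M i i + M j j) := by
    intro t
    set v : m → ℝ := Pi.single i 1 with hv
    set w : m → ℝ := Pi.single i 1 + Pi.single j t with hw
    have hvv : v ⬝ᵥ v = 1 := by simp [hv]
    have hvw : v ⬝ᵥ w = 1 := by simp [hv, hw, hij]
    have hww : w ⬝ᵥ w = 1 + t ^ 2 := by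
      simp [hw, hij, Ne.symm hij]
      ring
    have hpos : 0 < 1 + t ^ 2 := by positivity
    have hvMv : v ⬝ᵥ M *ᵥ v = M i i := by simp [hv]
    have hwMv : w ⬝ᵥ M *ᵥ v = M i i + t * M j i := by
      simp [hv, hw]
    have hwMw : w ⬝ᵥ M *ᵥ w = M i i + t * (M i j + M j i) + t ^ 2 * M j j := by
      simp [hw, Matrix.mulVec_add, Matrix.mulVec_single]
      ring
    have hR : (householder v * householder w)ᵀ * (householder v * householder w) = 1 := by
      rw [Matrix.transpose_mul, Matrix.mul_assoc, ← Matrix.mul_assoc (householder v)ᵀ,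
        householder_transpose_mul_self v (by simp [hvv]), Matrix.one_mul,
        householder_transpose_mul_self w (by rw [hww]; exact hpos.ne')]
    have h := hM _ hR
    rw [Matrix.mul_assoc, trace_householder_mul, trace_householder_mul, ← Matrix.mulVec_mulVec,
      householder_mulVec, dotProduct_sub, dotProduct_smul, hvv, hvw, hww, hvMv, hwMv, hwMw,
      smul_eq_mul] at h
    field_simp at h
    nlinarith [h]
  have hb : 0 ≤ M i i + M j j := by
    have h₁ := key 1
    have h₂ := key (-1)
    linarith
  set a := M j i - M i j with ha
  set b := M i i + M j j with hb'
  have h := key (a / (b + 1))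
  have hb1 : 0 < b + 1 := by linarith
  field_simp at h
  have ha0 : a = 0 := by
    have : a ^ 2 ≤ 0 := by nlinarith
    exact pow_eq_zero_iff (two_ne_zero) |>.mp (le_antisymm this (sq_nonneg a))
  linarith

lemma trace_mul_transpose_self_nonneg (A : Matrix m n ℝ) : 0 ≤ (A * Aᵀ).trace := by
  rw [← frobNorm_sq_eq_trace]
  positivity

lemma sq_trace_le_card_mul_trace (W : Matrix m m ℝ) :
    W.trace ^ 2 ≤ Fintype.card m * (W * Wᵀ).trace := by
  have h₁ : W.trace ^ 2 ≤ Fintype.card m * ∑ i, W i i ^ 2 :=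
    sq_sum_le_card_mul_sum_sq
  have h₂ : ∑ i, W i i ^ 2 ≤ (W * Wᵀ).trace := by
    simp only [Matrix.trace, Matrix.diag_apply, Matrix.mul_apply, Matrix.transpose_apply, ← sq]
    exact Finset.sum_le_sum fun i _ =>
      Finset.single_le_sum (f := fun j => W i j ^ 2) (fun j _ => sq_nonneg _) (Finset.mem_univ i)
  exact h₁.trans (by gcongr)

/-- If `Z Yᵀ` is symmetric positive semidefinite, then
`‖Z - Y‖_F⁴ ≤ 2 D ‖ZᵀZ - YᵀY‖_F²`, where `D` is the number of rows. -/
lemma frobNorm_sub_pow_four_le (Z Y : Matrix m n ℝ) (hsymm : (Z * Yᵀ)ᵀ = Z * Yᵀ)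
    (hpos : ∀ v : m → ℝ, 0 ≤ v ⬝ᵥ (Z * Yᵀ) *ᵥ v) :
    frobNorm (Z - Y) ^ 4 ≤ 2 * Fintype.card m * frobNorm (Zᵀ * Z - Yᵀ * Y) ^ 2 := by
  set A := Z * Zᵀ with hA
  set B := Y * Yᵀ with hB
  set M := Z * Yᵀ with hM
  set W := (Z - Y) * (Z - Y)ᵀ with hW
  have hYZ : Y * Zᵀ = M := by
    rw [← hsymm, hM, Matrix.transpose_mul, Matrix.transpose_transpose]
  have hAt : Aᵀ = A := by simp [hA]
  have hBt : Bᵀ = B := by simp [hB]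
  have hWt : Wᵀ = W := by rw [hW, Matrix.transpose_mul, Matrix.transpose_transpose]
  have hWeq : W = A + B - M - M := by
    rw [hW, Matrix.transpose_sub, Matrix.sub_mul, Matrix.mul_sub, Matrix.mul_sub, hYZ]
    abel
  have hAB : 0 ≤ ((A - B) * (A - B)).trace := by
    have := trace_mul_transpose_self_nonneg (A - B)
    rwa [Matrix.transpose_sub, hAt, hBt] at this
  have hWM : 0 ≤ (W * M).trace := by
    rw [hW, Matrix.mul_assoc, Matrix.trace_mul_comm, Matrix.trace]
    refine Finset.sum_nonneg fun k _ => ?_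
    have := hpos fun d => (Z - Y) d k
    rw [Matrix.dotProduct_mulVec] at this
    exact this
  have hG : frobNorm (Zᵀ * Z - Yᵀ * Y) ^ 2 =
      (A * A).trace + (B * B).trace - 2 * (M * M).trace := by
    have e₁ : (Zᵀ * Z * (Zᵀ * Z)).trace = (A * A).trace := by
      rw [Matrix.mul_assoc, Matrix.trace_mul_comm, hA]
      simp only [Matrix.mul_assoc]
    have e₂ : (Yᵀ * Y * (Yᵀ * Y)).trace = (B * B).trace := by
      rw [Matrix.mul_assoc, Matrix.trace_mul_comm, hB]
      simp only [Matrix.mul_assoc]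
    have e₃ : (Zᵀ * Z * (Yᵀ * Y)).trace = (M * M).trace := by
      nth_rewrite 2 [← hYZ]
      rw [Matrix.mul_assoc, Matrix.trace_mul_comm, hM]
      simp only [Matrix.mul_assoc]
    rw [frobNorm_sq_eq_trace, Matrix.transpose_sub, Matrix.transpose_mul, Matrix.transpose_mul,
      Matrix.transpose_transpose, Matrix.transpose_transpose, Matrix.sub_mul, Matrix.mul_sub,
      Matrix.mul_sub, Matrix.trace_sub, Matrix.trace_sub, Matrix.trace_sub,
      Matrix.trace_mul_comm (Yᵀ * Y) (Zᵀ * Z), e₁, e₂, e₃]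
    ring
  have hWW : (W * Wᵀ).trace ≤ 2 * frobNorm (Zᵀ * Z - Yᵀ * Y) ^ 2 := by
    rw [hG, hWt]
    rw [hWeq] at hWM ⊢
    simp only [Matrix.add_mul, Matrix.mul_add, Matrix.sub_mul, Matrix.mul_sub, Matrix.trace_add,
      Matrix.trace_sub, Matrix.trace_mul_comm B A, Matrix.trace_mul_comm M A,
      Matrix.trace_mul_comm M B] at hWM hAB ⊢
    linarith
  calc frobNorm (Z - Y) ^ 4 = W.trace ^ 2 := by
        rw [hW, ← frobNorm_sq_eq_trace]
        ring
    _ ≤ Fintype.card m * (W * Wᵀ).trace := sq_trace_le_card_mul_trace W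
    _ ≤ Fintype.card m * (2 * frobNorm (Zᵀ * Z - Yᵀ * Y) ^ 2) := by gcongr
    _ = _ := by ring

/-- At an optimal orthogonal alignment `Q`, the squared Procrustes error is at most
`√(2D) ‖XᵀX - YᵀY‖_F`. -/
lemma frobNorm_procrustes_sq_le [DecidableEq m] (X Y : Matrix m n ℝ) (Q : Matrix m m ℝ)
    (hQ : Qᵀ * Q = 1)
    (hQmin : ∀ Q' : Matrix m m ℝ, Q'ᵀ * Q' = 1 → frobNorm (Q * X - Y) ≤ frobNorm (Q' * X - Y)) :
    frobNorm (Q * X - Y) ^ 2 ≤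
      Real.sqrt (2 * Fintype.card m) * frobNorm (Xᵀ * X - Yᵀ * Y) := by
  have hmax : ∀ R : Matrix m m ℝ, Rᵀ * R = 1 →
      (R * (Q * X * Yᵀ)).trace ≤ (Q * X * Yᵀ).trace := by
    intro R hR
    have hRQ : (R * Q)ᵀ * (R * Q) = 1 := by
      rw [Matrix.transpose_mul, Matrix.mul_assoc, ← Matrix.mul_assoc Rᵀ, hR, Matrix.one_mul, hQ]
    have h := pow_le_pow_left₀ (Real.sqrt_nonneg _) (hQmin _ hRQ) 2
    have h₁ := frobNorm_orthogonal_mul_sub_sq 1 (by simp) (Q * X) Y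
    rw [Matrix.one_mul, Matrix.one_mul] at h₁
    rw [Matrix.mul_assoc R Q X, frobNorm_orthogonal_mul_sub_sq R hR] at h
    change frobNorm (Q * X - Y) ^ 2 ≤ _ at h
    linarith
  have h := frobNorm_sub_pow_four_le (Q * X) Y (transpose_eq_of_trace_max _ hmax)
    (dotProduct_mulVec_nonneg_of_trace_max _ hmax)
  rw [Matrix.transpose_mul, Matrix.mul_assoc, ← Matrix.mul_assoc Qᵀ, hQ, Matrix.one_mul] at h
  refine le_of_sq_le_sq ?_ (mul_nonneg (Real.sqrt_nonneg _) (Real.sqrt_nonneg _))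
  rw [mul_pow, Real.sq_sqrt (by positivity)]
  linarith [h, pow_mul (frobNorm (Q * X - Y)) 2 2]

/-- Cauchy–Schwarz for the entries of `EᵀU` when `U` has unit columns. -/
lemma sum_sq_dotProduct_le (E U : Matrix m n ℝ) (hU : ∀ j, ∑ d, U d j ^ 2 = 1) :
    ∑ i, ∑ j, (∑ d, E d i * U d j) ^ 2 ≤ Fintype.card n * frobNorm E ^ 2 := by
  have h : ∀ i j, (∑ d, E d i * U d j) ^ 2 ≤ ∑ d, E d i ^ 2 := fun i j => by
    simpa [hU j] using Finset.sum_mul_sq_le_sq_mul_sq Finset.univ (fun d => E d i) (fun d => U d j)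
  calc ∑ i, ∑ j, (∑ d, E d i * U d j) ^ 2 ≤ ∑ i, ∑ _j : n, ∑ d, E d i ^ 2 :=
        Finset.sum_le_sum fun i _ => Finset.sum_le_sum fun j _ => h i j
    _ = Fintype.card n * frobNorm E ^ 2 := by
        rw [frobNorm, Real.sq_sqrt (by positivity), Finset.sum_comm (s := (Finset.univ : Finset m))]
        simp [Finset.mul_sum]

end Auxiliary

/-- **Corollary (cross-similarities).** Suppose the columns of `X` and `Y` are unit vectors
and the average squared deviation of pairwise dot products is at most `δ²`.  If `Q` is an
orthogonal matrix minimizing `‖QX − Y‖_F` over all orthogonal matrices, and `x̄ᵢ = Q xᵢ`,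
then the average squared deviations of the cross-similarities `x̄ᵢᵀyⱼ` from both
`yᵢᵀyⱼ` and `xᵢᵀxⱼ` are at most `√(2D) δ`. -/
theorem procrustes_cross_similarity_bound (D N : ℕ) (hD : 0 < D) (hN : 0 < N)
    (X Y : Matrix (Fin D) (Fin N) ℝ) (δ : ℝ) (hδ : 0 ≤ δ)
    (hXunit : ∀ i : Fin N, ∑ d : Fin D, (X d i) ^ 2 = 1)
    (hYunit : ∀ i : Fin N, ∑ d : Fin D, (Y d i) ^ 2 = 1)
    (h : (1 / (N : ℝ) ^ 2) *
        ∑ i : Fin N, ∑ j : Fin N,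
          ((∑ d : Fin D, X d i * X d j) - (∑ d : Fin D, Y d i * Y d j)) ^ 2 ≤ δ ^ 2)
    (Q : Matrix (Fin D) (Fin D) ℝ) (hQ : Qᵀ * Q = 1)
    (hQmin : ∀ Q' : Matrix (Fin D) (Fin D) ℝ, Q'ᵀ * Q' = 1 →
      frobNorm (Q * X - Y) ≤ frobNorm (Q' * X - Y)) :
    (1 / (N : ℝ) ^ 2) *
        ∑ i : Fin N, ∑ j : Fin N,
          ((∑ d : Fin D, Q.mulVec (fun e => X e i) d * Y d j) -
            (∑ d : Fin D, Y d i * Y d j)) ^ 2 ≤ Real.sqrt (2 * D) * δ ∧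
    (1 / (N : ℝ) ^ 2) *
        ∑ i : Fin N, ∑ j : Fin N,
          ((∑ d : Fin D, Q.mulVec (fun e => X e i) d * Y d j) -
            (∑ d : Fin D, X d i * X d j)) ^ 2 ≤ Real.sqrt (2 * D) * δ := by
  have hN' : (0 : ℝ) < N := by exact_mod_cast hN
  have hG : frobNorm (Xᵀ * X - Yᵀ * Y) ≤ N * δ := by
    refine Real.sqrt_le_iff.mpr ⟨by positivity, ?_⟩
    rw [one_div, inv_mul_le_iff₀ (by positivity), ← mul_pow] at h
    simpa [Matrix.mul_apply] using h
  have hE : frobNorm (Q * X - Y) ^ 2 ≤ N * (Real.sqrt (2 * D) * δ) := by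
    have h₁ := frobNorm_procrustes_sq_le X Y Q hQ hQmin
    rw [Fintype.card_fin] at h₁
    calc _ ≤ _ := h₁
      _ ≤ Real.sqrt (2 * D) * (N * δ) := by gcongr
      _ = _ := by ring
  have bound : ∀ U : Matrix (Fin D) (Fin N) ℝ, (∀ j, ∑ d, U d j ^ 2 = 1) →
      (1 / (N : ℝ) ^ 2) * ∑ i, ∑ j, (∑ d, (Q * X - Y) d i * U d j) ^ 2 ≤
        Real.sqrt (2 * D) * δ := by
    intro U hU
    have h₁ := sum_sq_dotProduct_le (Q * X - Y) U hU
    rw [Fintype.card_fin] at h₁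
    rw [one_div, inv_mul_le_iff₀ (by positivity)]
    calc _ ≤ _ := h₁
      _ ≤ N * (N * (Real.sqrt (2 * D) * δ)) := by gcongr
      _ = _ := by ring
  have hdot : ∀ i j, ∑ d, X d i * X d j = ∑ d, (Q * X) d i * (Q * X) d j := by
    intro i j
    have h₁ : (Q * X)ᵀ * (Q * X) = Xᵀ * X := by
      rw [Matrix.transpose_mul, Matrix.mul_assoc, ← Matrix.mul_assoc Qᵀ, hQ, Matrix.one_mul]
    simpa only [Matrix.mul_apply, Matrix.transpose_apply] using (congrFun₂ h₁ i j).symm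
  have hmulVec : ∀ i d, Q.mulVec (fun e => X e i) d = (Q * X) d i := fun _ _ => rfl
  simp only [hmulVec]
  constructor
  · simpa only [Matrix.sub_apply, sub_mul, Finset.sum_sub_distrib] using bound Y hYunit
  · have hQX : ∀ j, ∑ d, (Q * X) d j ^ 2 = 1 := fun j => by
      simp only [sq, ← hdot, ← hXunit j]
    have h₁ := bound (Q * X) hQX
    rw [Finset.sum_comm] at h₁
    refine (le_of_eq (congrArg _ ?_)).trans h₁
    refine Finset.sum_congr rfl fun i _ => Finset.sum_congr rfl fun j _ => ?_
    rw [hdot, sub_sq_comm]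
    simp only [Matrix.sub_apply, mul_comm, mul_sub, Finset.sum_sub_distrib]
end

section
/- Let M, N, R be positive integers and let A, B be real M×N matrices with rank(A) ≤ R and rank(B) ≤ R. Then there exists an M×M orthogonal matrix P such that ‖PA − B‖_F ≤ ‖QA − B‖_F for every M×M orthogonal matrix Q, and rank(PA − B) ≤ R. -/
open Matrix

/-- Expansion of the squared Frobenius norm of `Q * A - B` for orthogonal `Q`. -/
lemma sum_sq_orthogonal_mul_sub {m n : Type*} [Fintype m] [Fintype n] [DecidableEq m]
    (A B : Matrix m n ℝ) {Q : Matrix m m ℝ} (hQ : Qᵀ * Q = 1) :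
    ∑ i, ∑ j, ((Q * A - B) i j) ^ 2 =
      trace (Aᵀ * A) + trace (Bᵀ * B) - 2 * trace (Q * (A * Bᵀ)) := by
  have sum_sq (X : Matrix m n ℝ) : ∑ i, ∑ j, (X i j) ^ 2 = trace (Xᵀ * X) := by
    rw [Finset.sum_comm]
    simp [trace, mul_apply, sq]
  have h1 : trace ((Q * A)ᵀ * (Q * A)) = trace (Aᵀ * A) := by
    rw [transpose_mul, Matrix.mul_assoc, ← Matrix.mul_assoc Qᵀ, hQ, Matrix.one_mul]
  have h2 : trace (Bᵀ * (Q * A)) = trace (Q * (A * Bᵀ)) := by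
    rw [trace_mul_comm, Matrix.mul_assoc]
  have h3 : trace ((Q * A)ᵀ * B) = trace (Bᵀ * (Q * A)) := by
    rw [← trace_transpose, transpose_mul, transpose_transpose]
  rw [sum_sq, transpose_sub, Matrix.sub_mul, Matrix.mul_sub, Matrix.mul_sub]
  simp only [trace_sub]
  rw [h1, h3, h2]
  ring

lemma isCompact_setOf_transpose_mul_self_eq_one (m : Type*) [Fintype m] [DecidableEq m] :
    IsCompact {Q : Matrix m m ℝ | Qᵀ * Q = 1} := by
  have hK : IsCompact (Set.univ.pi fun _ : m => Set.univ.pi fun _ : m => Set.Icc (-1 : ℝ) 1) :=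
    isCompact_univ_pi fun _ => isCompact_univ_pi fun _ => isCompact_Icc
  refine hK.of_isClosed_subset
    (isClosed_eq (by fun_prop) continuous_const : IsClosed {Q : Matrix m m ℝ | Qᵀ * Q = 1}) ?_
  intro (Q : Matrix m m ℝ) (hQ : Qᵀ * Q = 1) i _ j _
  have h : ∑ k, Q k j * Q k j = 1 := by
    simpa [mul_apply] using congrFun (congrFun hQ j) j
  have h' : Q i j * Q i j ≤ ∑ k, Q k j * Q k j :=
    Finset.single_le_sum (f := fun k => Q k j * Q k j)
      (fun k _ => mul_self_nonneg _) (Finset.mem_univ i)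
  exact abs_le.mp (abs_le_one_iff_mul_self_le_one.mpr (h'.trans h.le))

lemma exists_orthogonal_trace_mul_max {m : Type*} [Fintype m] [DecidableEq m]
    (C : Matrix m m ℝ) :
    ∃ P : Matrix m m ℝ, Pᵀ * P = 1 ∧
      ∀ Q : Matrix m m ℝ, Qᵀ * Q = 1 → trace (Q * C) ≤ trace (P * C) := by
  obtain ⟨P, hP, hmax⟩ := (isCompact_setOf_transpose_mul_self_eq_one m).exists_isMaxOn
    ⟨1, by simp⟩ (f := fun Q : Matrix m m ℝ => trace (Q * C)) (by fun_prop)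
  exact ⟨P, hP, fun Q hQ => hmax hQ⟩

lemma transpose_mul_self_rotation {m : Type*} [Fintype m] [DecidableEq m]
    {S : Matrix m m ℝ} (hS : Sᵀ = -S) (hS3 : S * (S * S) = -S) {c s : ℝ}
    (hcs : c ^ 2 + s ^ 2 = 1) :
    (1 + s • S + (1 - c) • (S * S))ᵀ * (1 + s • S + (1 - c) • (S * S)) = 1 := by
  have hS4 : S * S * (S * S) = -(S * S) := by
    rw [Matrix.mul_assoc, hS3, Matrix.mul_neg]
  have hS3' : S * S * S = -S := by rw [Matrix.mul_assoc, hS3]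
  have hs : s * s = 1 - c * c := by linarith [hcs, sq c, sq s]
  simp only [transpose_add, transpose_smul, transpose_mul, transpose_one, hS]
  simp only [Matrix.add_mul, Matrix.mul_add, Matrix.smul_mul, Matrix.mul_smul, Matrix.neg_mul,
    Matrix.mul_neg, neg_neg, hS3, hS3', hS4, Matrix.one_mul, Matrix.mul_one, smul_neg, smul_smul,
    smul_add, hs]
  module

/-- If the identity maximizes `Q ↦ trace (Q * K)` over orthogonal `Q`, then `K` is symmetric. -/
lemma isSymm_of_trace_mul_le {m : Type*} [Fintype m] [DecidableEq m] {K : Matrix m m ℝ}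
    (hK : ∀ Q : Matrix m m ℝ, Qᵀ * Q = 1 → trace (Q * K) ≤ trace K) : K.IsSymm := by
  ext i j
  rw [transpose_apply]
  rcases eq_or_ne i j with rfl | hij
  · rfl
  set S : Matrix m m ℝ := single i j 1 - single j i 1 with hSdef
  have hS : Sᵀ = -S := by simp [hSdef]
  have hS3 : S * (S * S) = -S := by
    simp [hSdef, Matrix.mul_sub, Matrix.sub_mul, hij, hij.symm]
    abel
  have hb : trace (S * K) = K j i - K i j := by
    simp [hSdef, Matrix.sub_mul, trace_single_mul]
  set b := trace (S * K)
  set d := trace (S * S * K)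
  have key {c s : ℝ} (hcs : c ^ 2 + s ^ 2 = 1) : s * b + (1 - c) * d ≤ 0 := by
    have h := hK _ (transpose_mul_self_rotation hS hS3 hcs)
    simp only [Matrix.add_mul, Matrix.smul_mul, Matrix.one_mul, trace_add, trace_smul,
      smul_eq_mul] at h
    linarith
  suffices b = 0 by linarith
  by_contra hb0
  have hpos : 0 < b ^ 2 + d ^ 2 := by positivity
  set r := √(b ^ 2 + d ^ 2)
  have hr0 : 0 < r := Real.sqrt_pos.mpr hpos
  have hr2 : r ^ 2 = b ^ 2 + d ^ 2 := Real.sq_sqrt hpos.le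
  have h := key (c := -d / r) (s := b / r) (by field_simp; linarith)
  have h' : b / r * b + (1 - -d / r) * d = r + d := by
    field_simp
    linarith
  have hb2 : 0 < b ^ 2 := by positivity
  nlinarith

lemma exists_linearIsometry_of_finrank_le {U V : Type*} [NormedAddCommGroup U]
    [InnerProductSpace ℝ U] [FiniteDimensional ℝ U] [NormedAddCommGroup V]
    [InnerProductSpace ℝ V] [FiniteDimensional ℝ V]
    (h : Module.finrank ℝ U ≤ Module.finrank ℝ V) : Nonempty (U →ₗᵢ[ℝ] V) := by
  let u := stdOrthonormalBasis ℝ U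
  let v := stdOrthonormalBasis ℝ V
  refine ⟨(u.toBasis.constr ℝ (v ∘ Fin.castLE h)).isometryOfOrthonormal (v := u.toBasis)
    (by simp) ?_⟩
  have : (u.toBasis.constr ℝ (v ∘ Fin.castLE h)) ∘ u.toBasis = v ∘ Fin.castLE h := by
    ext k
    simp only [Function.comp_apply, Module.Basis.constr_basis]
  rw [this]
  exact v.orthonormal.comp _ (Fin.castLE_injective h)

/-- An isometry sending `W ≤ U` into `V` can be changed off `W` so as to send all of `U` into `V`,
provided that `V` is large enough. -/
lemma LinearIsometry.exists_eqOn_mapsTo {E : Type*} [NormedAddCommGroup E]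
    [InnerProductSpace ℝ E] [FiniteDimensional ℝ E] {U V W : Submodule ℝ E} (hWU : W ≤ U)
    (hUV : Module.finrank ℝ U ≤ Module.finrank ℝ V) (P : E →ₗᵢ[ℝ] E)
    (hP : ∀ w ∈ W, P w ∈ V) :
    ∃ P' : E →ₗᵢ[ℝ] E, (∀ w ∈ W, P' w = P w) ∧ ∀ u ∈ U, P' u ∈ V := by
  obtain ⟨J⟩ := exists_linearIsometry_of_finrank_le hUV
  let j : W →ₗᵢ[ℝ] V := J.comp ⟨Submodule.inclusion hWU, fun _ => rfl⟩
  let L₀ : W →ₗᵢ[ℝ] V :=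
    ⟨(P.toLinearMap.comp W.subtype).codRestrict V fun w => hP w w.2, fun w => P.norm_map w⟩
  let L : j.range →ₗᵢ[ℝ] V := L₀.comp j.equivRange.symm.toLinearIsometry
  let K : U →ₗᵢ[ℝ] E := V.subtypeₗᵢ.comp (L.extend.comp J)
  refine ⟨K.extend, fun w hw => ?_, fun u hu => ?_⟩
  · have h1 := K.extend_apply ⟨w, hWU hw⟩
    have h2 := L.extend_apply (j.equivRange ⟨w, hw⟩)
    have h3 : L (j.equivRange ⟨w, hw⟩) = L₀ ⟨w, hw⟩ := by simp [L]
    exact h1.trans (congrArg Subtype.val (h2.trans h3))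
  · have h1 := K.extend_apply ⟨u, hu⟩
    rw [show K.extend u = K ⟨u, hu⟩ from h1]
    exact (L.extend (J ⟨u, hu⟩)).2

lemma rank_eq_finrank_range_toEuclideanLin {m n : Type*} [Fintype m] [Fintype n] [DecidableEq n]
    (A : Matrix m n ℝ) : A.rank = Module.finrank ℝ (toEuclideanLin A).range := by
  classical
  rw [toEuclideanLin, toLpLin_eq_toLin]
  exact rank_eq_finrank_range_toLin A _ _

lemma transpose_mul_self_eq_one_iff_norm_toEuclideanLin {m : Type*} [Fintype m] [DecidableEq m]
    (Q : Matrix m m ℝ) : Qᵀ * Q = 1 ↔ ∀ x, ‖toEuclideanLin Q x‖ = ‖x‖ := by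
  have h : Qᵀ * Q = 1 ↔ (toEuclideanLin Q).adjoint ∘ₗ toEuclideanLin Q = LinearMap.id := by
    rw [← toEuclideanLin_conjTranspose_eq_adjoint, conjTranspose_eq_transpose_of_trivial,
      ← toLpLin_mul, ← toLpLin_one, EmbeddingLike.apply_eq_iff_eq]
  rw [h, LinearMap.norm_map_iff_inner_map_map (𝕜 := ℝ)]
  simp_rw [← LinearMap.adjoint_inner_left]
  exact ⟨fun h x y => congrArg (inner ℝ · y) (LinearMap.congr_fun h x),
    fun h => LinearMap.ext fun x => ext_inner_right ℝ (h x)⟩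

/-- If `rank A ≤ rank B`, some maximizer of `Q ↦ trace (Q * (A * Bᵀ))` over orthogonal `Q` sends
the column space of `A` into that of `B`. -/
lemma exists_orthogonal_trace_max_rank_sub_le {m n : Type*} [Fintype m] [Fintype n]
    [DecidableEq m] [DecidableEq n] (A B : Matrix m n ℝ) (h : A.rank ≤ B.rank) :
    ∃ P : Matrix m m ℝ, Pᵀ * P = 1 ∧
      (∀ Q : Matrix m m ℝ, Qᵀ * Q = 1 → trace (Q * (A * Bᵀ)) ≤ trace (P * (A * Bᵀ))) ∧
      (P * A - B).rank ≤ B.rank := by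
  obtain ⟨P, hP, hmax⟩ := exists_orthogonal_trace_mul_max (A * Bᵀ)
  have hsymm : (P * (A * Bᵀ)).IsSymm := isSymm_of_trace_mul_le fun Q hQ => by
    rw [← Matrix.mul_assoc]
    refine hmax _ ?_
    rw [transpose_mul, Matrix.mul_assoc, ← Matrix.mul_assoc Qᵀ, hQ, Matrix.one_mul, hP]
  have hPC : P * (A * Bᵀ) = B * (P * A)ᵀ := by
    rw [← hsymm.eq, ← Matrix.mul_assoc, transpose_mul, transpose_transpose]
  rw [rank_eq_finrank_range_toEuclideanLin, rank_eq_finrank_range_toEuclideanLin] at h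
  obtain ⟨T, hTW, hTU⟩ := LinearIsometry.exists_eqOn_mapsTo
    (W := (toEuclideanLin (A * Bᵀ)).range) (by
      rw [toEuclideanLin, toLpLin_mul (q := 2)]
      exact LinearMap.range_comp_le_range _ _) h
    ⟨toEuclideanLin P, (transpose_mul_self_eq_one_iff_norm_toEuclideanLin P).mp hP⟩ (by
      rintro _ ⟨x, rfl⟩
      refine ⟨toEuclideanLin (P * A)ᵀ x, ?_⟩
      change (toEuclideanLin B ∘ₗ toEuclideanLin (P * A)ᵀ) x =
        (toEuclideanLin P ∘ₗ toEuclideanLin (A * Bᵀ)) x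
      rw [← toLpLin_mul, ← toLpLin_mul, hPC])
  obtain ⟨P', hP'⟩ := (toEuclideanLin (𝕜 := ℝ) (m := m) (n := m)).surjective T.toLinearMap
  have hP'C : P' * (A * Bᵀ) = P * (A * Bᵀ) := by
    apply (toEuclideanLin (𝕜 := ℝ) (m := m) (n := m)).injective
    rw [toEuclideanLin, toLpLin_mul 2 2 2 P', toLpLin_mul 2 2 2 P, ← toEuclideanLin, hP']
    exact LinearMap.ext fun x => hTW _ ⟨x, rfl⟩
  refine ⟨P', ?_, fun Q hQ => hP'C ▸ hmax Q hQ, ?_⟩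
  · rw [transpose_mul_self_eq_one_iff_norm_toEuclideanLin, hP']
    exact T.norm_map
  · rw [rank_eq_finrank_range_toEuclideanLin, rank_eq_finrank_range_toEuclideanLin]
    apply Submodule.finrank_mono
    rintro _ ⟨x, rfl⟩
    rw [map_sub, LinearMap.sub_apply, toEuclideanLin, toLpLin_mul (q := 2)]
    refine Submodule.sub_mem _ ?_ ⟨x, rfl⟩
    change toEuclideanLin P' _ ∈ _
    rw [hP']
    exact hTU _ ⟨x, rfl⟩

/-- **Low-rank optimal alignment.** If `rank(A) ≤ R` and `rank(B) ≤ R`, then some optimal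
orthogonal Procrustes solution `P` (minimizing `‖QA − B‖_F` over orthogonal `Q`) has a
residual `PA − B` of rank at most `R`. -/
theorem exists_optimal_orthogonal_with_low_rank_residual (M N R : ℕ)
    (hM : 0 < M) (hN : 0 < N) (hR : 0 < R)
    (A B : Matrix (Fin M) (Fin N) ℝ) (hA : A.rank ≤ R) (hB : B.rank ≤ R) :
    ∃ P : Matrix (Fin M) (Fin M) ℝ, Pᵀ * P = 1 ∧
      (∀ Q : Matrix (Fin M) (Fin M) ℝ, Qᵀ * Q = 1 →
        frobNorm (P * A - B) ≤ frobNorm (Q * A - B)) ∧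
      (P * A - B).rank ≤ R := by
  suffices ∃ P : Matrix (Fin M) (Fin M) ℝ, Pᵀ * P = 1 ∧
      (∀ Q : Matrix (Fin M) (Fin M) ℝ, Qᵀ * Q = 1 →
        trace (Q * (A * Bᵀ)) ≤ trace (P * (A * Bᵀ))) ∧ (P * A - B).rank ≤ R by
    obtain ⟨P, hP, hmax, hrank⟩ := this
    refine ⟨P, hP, fun Q hQ => Real.sqrt_le_sqrt ?_, hrank⟩
    rw [sum_sq_orthogonal_mul_sub A B hP, sum_sq_orthogonal_mul_sub A B hQ]
    linarith [hmax Q hQ]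
  rcases le_total A.rank B.rank with h | h
  · obtain ⟨P, hP, hmax, hrank⟩ := exists_orthogonal_trace_max_rank_sub_le A B h
    exact ⟨P, hP, hmax, hrank.trans hB⟩
  · obtain ⟨P, hP, hmax, hrank⟩ := exists_orthogonal_trace_max_rank_sub_le B A h
    have trace_swap (Q : Matrix (Fin M) (Fin M) ℝ) :
        trace (Qᵀ * (B * Aᵀ)) = trace (Q * (A * Bᵀ)) := by
      rw [← trace_transpose, transpose_mul, transpose_mul, transpose_transpose,
        transpose_transpose, trace_mul_comm]
    refine ⟨Pᵀ, by rw [transpose_transpose, mul_eq_one_comm.mp hP], fun Q hQ => ?_, ?_⟩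
    · rw [← trace_swap Q, ← trace_swap Pᵀ, transpose_transpose]
      exact hmax _ (by rw [transpose_transpose, mul_eq_one_comm.mp hQ])
    · have hres : Pᵀ * A - B = -Pᵀ * (P * B - A) := by
        rw [Matrix.neg_mul, Matrix.mul_sub, ← Matrix.mul_assoc, hP, Matrix.one_mul, neg_sub]
      rw [hres]
      exact (rank_mul_le_right _ _).trans (hrank.trans hA)
end

section
/- Let X, Y be real D×N matrices, and let |X| = (XᵀX)^{1/2} and |Y| = (YᵀY)^{1/2} denote the unique N×N positive semidefinite square roots of their Gram matrices. Then there exists a D×D orthogonal matrix Q such that ‖QX − Y‖_F ≤ ‖ |X| − |Y| ‖_F. -/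
open Matrix

/-- Real matrices of the same shape with equal Gram matrices differ by an orthogonal factor. -/
theorem exists_orthogonal_mul_eq_of_gram_eq {m n : Type*} [Fintype m] [DecidableEq m]
    [Fintype n] [DecidableEq n] (A B : Matrix m n ℝ) (h : Aᵀ * A = Bᵀ * B) :
    ∃ Q : Matrix m m ℝ, Qᵀ * Q = 1 ∧ Q * A = B := by
  have hnorm (x : EuclideanSpace ℝ n) : ‖toEuclideanLin A x‖ = ‖toEuclideanLin B x‖ := by
    have key (C : Matrix m n ℝ) :
        ‖toEuclideanLin C x‖ ^ 2 = x.ofLp ⬝ᵥ ((Cᵀ * C) *ᵥ x.ofLp) := by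
      rw [EuclideanSpace.real_norm_sq_eq, ← mulVec_mulVec, dotProduct_mulVec, vecMul_transpose]
      simp [dotProduct, toLpLin_apply, sq]
    rw [← sq_eq_sq₀ (norm_nonneg _) (norm_nonneg _), key, key, h]
  obtain ⟨g, hg⟩ := (toEuclideanLin A).rangeRestrict.exists_rightInverse_of_surjective
    (LinearMap.range_rangeRestrict _)
  have hg' (y : (toEuclideanLin A).range) : toEuclideanLin A (g y) = y :=
    congrArg Subtype.val (LinearMap.congr_fun hg y)
  let L : (toEuclideanLin A).range →ₗᵢ[ℝ] EuclideanSpace ℝ m :=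
    { toLinearMap := toEuclideanLin B ∘ₗ g
      norm_map' := fun y ↦ by
        rw [LinearMap.comp_apply, ← hnorm, hg', Submodule.coe_norm] }
  have hL (x : EuclideanSpace ℝ n) : L.extend (toEuclideanLin A x) = toEuclideanLin B x := by
    change L.extend ((toEuclideanLin A).rangeRestrict x : EuclideanSpace ℝ m) = _
    rw [L.extend_apply]
    change toEuclideanLin B (g _) = _
    rw [← sub_eq_zero, ← map_sub, ← norm_eq_zero, ← hnorm, map_sub, hg',
      LinearMap.codRestrict_apply, sub_self, norm_zero]
  obtain ⟨Q, hQ⟩ := toEuclideanLin.surjective L.extend.toLinearMap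
  have hQ' (x : EuclideanSpace ℝ m) : toEuclideanLin Q x = L.extend x := by rw [hQ]; rfl
  refine ⟨Q, ?_, ?_⟩
  · ext i j
    have := L.extend.inner_map_map (EuclideanSpace.single i 1) (EuclideanSpace.single j 1)
    rw [← hQ', ← hQ'] at this
    simpa [PiLp.inner_apply, toLpLin_apply, mul_apply, one_apply, mul_comm, eq_comm,
      Pi.single_apply] using this
  · apply toEuclideanLin.injective
    ext1 x
    rw [← hL, ← hQ']
    simp [toLpLin_apply]

open scoped MatrixOrder in
theorem exists_eq_conjTranspose_mul_self_of_posSemidef {m : Type*} [Fintype m] [DecidableEq m]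
    {P : Matrix m m ℝ} (hP : P.PosSemidef) : ∃ B : Matrix m m ℝ, P = Bᴴ * B :=
  CStarAlgebra.nonneg_iff_eq_star_mul_self.mp hP.nonneg

/-- Left multiplication by an orthogonal matrix does not increase the trace of a positive
semidefinite matrix. -/
theorem trace_mul_le_trace_of_posSemidef {m : Type*} [Fintype m] [DecidableEq m]
    {O P : Matrix m m ℝ} (hO : Oᵀ * O = 1) (hP : P.PosSemidef) :
    (O * P).trace ≤ P.trace := by
  obtain ⟨B, rfl⟩ := exists_eq_conjTranspose_mul_self_of_posSemidef hP
  rw [conjTranspose_eq_transpose_of_trivial]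
  have h0 := (posSemidef_conjTranspose_mul_self (B - B * O)).trace_nonneg
  have h1 : ((B * O)ᵀ * (B * O)).trace = (Bᵀ * B).trace := by
    rw [trace_mul_comm, transpose_mul, Matrix.mul_assoc, ← Matrix.mul_assoc O,
      mul_eq_one_comm.1 hO, Matrix.one_mul, trace_mul_comm]
  have h2 : (Bᵀ * (B * O)).trace = (O * (Bᵀ * B)).trace := by
    rw [← Matrix.mul_assoc, trace_mul_comm]
  have h3 : ((B * O)ᵀ * B).trace = (O * (Bᵀ * B)).trace := by
    rw [← h2, ← trace_transpose, transpose_mul, transpose_transpose]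
  rw [conjTranspose_eq_transpose_of_trivial, transpose_sub, Matrix.sub_mul, Matrix.mul_sub,
    Matrix.mul_sub, trace_sub, trace_sub, trace_sub, h1, h2, h3] at h0
  linarith

open scoped MatrixOrder in
/-- A square real matrix becomes positive semidefinite after left multiplication by a suitable
orthogonal matrix. -/
theorem exists_orthogonal_mul_posSemidef {m : Type*} [Fintype m] [DecidableEq m]
    (M : Matrix m m ℝ) : ∃ Q : Matrix m m ℝ, Qᵀ * Q = 1 ∧ (Q * M).PosSemidef := by
  have hM : 0 ≤ Mᵀ * M := (posSemidef_conjTranspose_mul_self M).nonneg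
  have hP : (CFC.sqrt (Mᵀ * M)).PosSemidef := (CFC.sqrt_nonneg (Mᵀ * M)).posSemidef
  obtain ⟨Q, hQ, hQM⟩ := exists_orthogonal_mul_eq_of_gram_eq M (CFC.sqrt (Mᵀ * M)) (by
    rw [← conjTranspose_eq_transpose_of_trivial (CFC.sqrt _), hP.isHermitian.eq,
      CFC.sqrt_mul_sqrt_self _ hM])
  exact ⟨Q, hQ, hQM ▸ hP⟩

/-- The trace inner product of square matrices `S` and `T` is at most that of matrices `X` and `Y`
with the same Gram matrices, once `X` is optimally aligned with `Y`. -/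
theorem exists_orthogonal_trace_le_of_gram_eq {m n : Type*} [Fintype m] [DecidableEq m]
    [Fintype n] [DecidableEq n] (X Y : Matrix m n ℝ) (S T : Matrix n n ℝ)
    (hS : Sᵀ * S = Xᵀ * X) (hT : Tᵀ * T = Yᵀ * Y) :
    ∃ Q : Matrix m m ℝ, Qᵀ * Q = 1 ∧ (Tᵀ * S).trace ≤ (Yᵀ * (Q * X)).trace := by
  obtain ⟨Q, hQ, hP⟩ := exists_orthogonal_mul_posSemidef (X * Yᵀ)
  refine ⟨Q, hQ, ?_⟩
  have extend (Z : Matrix m n ℝ) (R : Matrix n n ℝ) (h : Rᵀ * R = Zᵀ * Z) :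
      ∃ O : Matrix (m ⊕ n) (m ⊕ n) ℝ, Oᵀ * O = 1 ∧
        O * fromRows Z (0 : Matrix n n ℝ) = fromRows (0 : Matrix m n ℝ) R :=
    exists_orthogonal_mul_eq_of_gram_eq _ _ (by
      simp [transpose_fromRows, fromCols_mul_fromRows, h])
  obtain ⟨U, hU, hUX⟩ := extend X S hS
  obtain ⟨V, hV, hVY⟩ := extend Y T hT
  have hQ' : Q * Qᵀ = 1 := mul_eq_one_comm.1 hQ
  have hM : fromRows X (0 : Matrix n n ℝ) * (fromRows Y (0 : Matrix n n ℝ))ᵀ =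
      fromBlocks Qᵀ 0 0 1 * fromBlocks (Q * (X * Yᵀ)) 0 0 (0 : Matrix n n ℝ) := by
    rw [transpose_fromRows, fromRows_mul_fromCols]
    simp [fromBlocks_multiply, ← Matrix.mul_assoc, hQ]
  have hO : (Vᵀ * U * fromBlocks Qᵀ 0 0 1)ᵀ * (Vᵀ * U * fromBlocks Qᵀ 0 0 1) = 1 := by
    have hB : (fromBlocks Qᵀ 0 0 (1 : Matrix n n ℝ))ᵀ *
        fromBlocks Qᵀ 0 0 (1 : Matrix n n ℝ) = 1 := by
      simp [fromBlocks_transpose, fromBlocks_multiply, hQ']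
    calc _ = (fromBlocks Qᵀ 0 0 1)ᵀ * (Uᵀ * (V * Vᵀ) * U) * fromBlocks Qᵀ 0 0 1 := by
          simp only [transpose_mul, transpose_transpose, Matrix.mul_assoc]
      _ = 1 := by rw [mul_eq_one_comm.1 hV, Matrix.mul_one, hU, Matrix.mul_one, hB]
  have hPB : (fromBlocks (Q * (X * Yᵀ)) 0 0 (0 : Matrix n n ℝ)).PosSemidef := by
    obtain ⟨B, hB⟩ := exists_eq_conjTranspose_mul_self_of_posSemidef hP
    convert posSemidef_conjTranspose_mul_self
      (fromBlocks B 0 0 0 : Matrix (m ⊕ n) (m ⊕ n) ℝ) using 1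
    rw [fromBlocks_conjTranspose, fromBlocks_multiply, hB]
    simp
  calc (Tᵀ * S).trace =
          ((fromRows 0 T : Matrix (m ⊕ n) n ℝ)ᵀ * (fromRows 0 S : Matrix (m ⊕ n) n ℝ)).trace := by
        rw [transpose_fromRows, fromCols_mul_fromRows, Matrix.mul_zero, zero_add]
    _ = (Vᵀ * U * (fromRows X 0 * (fromRows Y 0)ᵀ)).trace := by
        rw [← hUX, ← hVY, transpose_mul, Matrix.mul_assoc, trace_mul_comm]
        simp only [Matrix.mul_assoc]
    _ ≤ (fromBlocks (Q * (X * Yᵀ)) 0 0 (0 : Matrix n n ℝ)).trace := by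
        rw [hM, ← Matrix.mul_assoc]
        exact trace_mul_le_trace_of_posSemidef hO hPB
    _ = (Yᵀ * (Q * X)).trace := by
        rw [← Matrix.trace_mul_comm, Matrix.mul_assoc]
        simp [trace]

theorem frobNorm_eq_sqrt_trace {m n : Type*} [Fintype m] [Fintype n] (A : Matrix m n ℝ) :
    frobNorm A = Real.sqrt (Aᵀ * A).trace := by
  rw [frobNorm, Finset.sum_comm]
  simp [trace, mul_apply, sq]

theorem trace_gram_sub {m n : Type*} [Fintype m] [Fintype n] (A B : Matrix m n ℝ) :
    ((A - B)ᵀ * (A - B)).trace =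
      (Aᵀ * A).trace + (Bᵀ * B).trace - 2 * (Bᵀ * A).trace := by
  have h : (Aᵀ * B).trace = (Bᵀ * A).trace := by
    rw [← trace_transpose, transpose_mul, transpose_transpose]
  rw [transpose_sub, Matrix.sub_mul, Matrix.mul_sub, Matrix.mul_sub, trace_sub, trace_sub,
    trace_sub, h]
  ring



/-- **Procrustes distance is controlled by matrix absolute values.** If
`|X| = (XᵀX)^{1/2}` and `|Y| = (YᵀY)^{1/2}` are the (unique) positive semidefinite square
roots of the Gram matrices of `X` and `Y`, then some orthogonal `Q` satisfies
`‖QX − Y‖_F ≤ ‖ |X| − |Y| ‖_F`. -/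
theorem procrustes_le_abs_diff (D N : ℕ)
    (X Y : Matrix (Fin D) (Fin N) ℝ)
    (absX absY : Matrix (Fin N) (Fin N) ℝ)
    (hXpsd : absX.PosSemidef) (hYpsd : absY.PosSemidef)
    (hXsq : absX * absX = Xᵀ * X) (hYsq : absY * absY = Yᵀ * Y) :
    ∃ Q : Matrix (Fin D) (Fin D) ℝ, Qᵀ * Q = 1 ∧
      frobNorm (Q * X - Y) ≤ frobNorm (absX - absY) := by
  have hX : absXᵀ * absX = Xᵀ * X := by
    rw [← conjTranspose_eq_transpose_of_trivial, hXpsd.isHermitian.eq, hXsq]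
  have hY : absYᵀ * absY = Yᵀ * Y := by
    rw [← conjTranspose_eq_transpose_of_trivial, hYpsd.isHermitian.eq, hYsq]
  obtain ⟨Q, hQ, hle⟩ := exists_orthogonal_trace_le_of_gram_eq X Y absX absY hX hY
  refine ⟨Q, hQ, ?_⟩
  have hQX : (Q * X)ᵀ * (Q * X) = Xᵀ * X := by
    rw [transpose_mul, Matrix.mul_assoc, ← Matrix.mul_assoc Qᵀ, hQ, Matrix.one_mul]
  rw [frobNorm_eq_sqrt_trace, frobNorm_eq_sqrt_trace, trace_gram_sub, trace_gram_sub, hQX, hX, hY]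
  gcongr
end
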